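/- arXiv:0912.5492 — 2 statements merged into one kernel-verified Lean document; each statement's English description precedes it below -/
import Mathlib

section
/- Let g1 and g2 be metrics on an open set U ⊆ ℝ^N, and define the affinor v^i_j(u) = Σ_s g1^{is}(u) (g2)_{sj}(u), where (g2)_{sj}(u) are the entries of the inverse matrix g2(u)⁻¹. Then g1 and g2 are almost compatible if and only if the Nijenhuis tensor of v vanishes identically on U. -/
open Matrix

/-- Partial derivative `∂f/∂u^j` of a scalar function on `ℝ^N`. -/
noncomputable def pd {N : ℕ} (f : (Fin N → ℝ) → ℝ) (j : Fin N) (u : Fin N → ℝ) : ℝ :=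
  fderiv ℝ f u (Pi.single j 1)

/-- Matrix-valued fields on `ℝ^N` (contravariant metrics, affinors, ...). -/
abbrev MetF (N : ℕ) := (Fin N → ℝ) → Matrix (Fin N) (Fin N) ℝ

/-- `g` is a contravariant metric on `U`: smooth, symmetric and invertible there. -/
def IsMetricOn {N : ℕ} (g : MetF N) (U : Set (Fin N → ℝ)) : Prop :=
  (∀ i j, ContDiffOn ℝ (⊤ : ℕ∞) (fun u => g u i j) U) ∧
  (∀ u ∈ U, (g u).IsSymm) ∧ (∀ u ∈ U, IsUnit (g u).det)

/-- Christoffel symbols `Γ^i_{jk}` of the Levi-Civita connection of the contravariant metric `g`,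
where the covariant metric `g_{ij}` is the matrix inverse of `g`. -/
noncomputable def christoffel {N : ℕ} (g : MetF N) (i j k : Fin N) (u : Fin N → ℝ) : ℝ :=
  (1 / 2) * ∑ s, g u i s *
    (pd (fun v => (g v)⁻¹ s k) j u + pd (fun v => (g v)⁻¹ j s) k u -
      pd (fun v => (g v)⁻¹ j k) s u)

/-- Raised Christoffel symbols `Γ^{ij}_k = Σ_s g^{is} Γ^j_{sk}`. -/
noncomputable def christoffelR {N : ℕ} (g : MetF N) (i j k : Fin N) (u : Fin N → ℝ) : ℝ :=
  ∑ s, g u i s * christoffel g j s k u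

/-- Riemannian curvature tensor `R^i_{jkl}` of the contravariant metric `g`. -/
noncomputable def curvature {N : ℕ} (g : MetF N) (i j k l : Fin N) (u : Fin N → ℝ) : ℝ :=
  pd (christoffel g i j l) k u - pd (christoffel g i j k) l u +
    ∑ p, (christoffel g i p k u * christoffel g p j l u -
          christoffel g i p l u * christoffel g p j k u)

/-- Raised curvature tensor `R^{ij}_{kl} = Σ_s g^{is} R^j_{skl}`. -/
noncomputable def curvatureR {N : ℕ} (g : MetF N) (i j k l : Fin N) (u : Fin N → ℝ) : ℝ :=
  ∑ s, g u i s * curvature g j s k l u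

/-- Two metrics are almost compatible on `U` if the raised Christoffel symbols of every
(invertible) linear combination are the corresponding linear combination. -/
def AlmostCompatibleOn {N : ℕ} (g1 g2 : MetF N) (U : Set (Fin N → ℝ)) : Prop :=
  ∀ l1 l2 : ℝ, ∀ u ∈ U, IsUnit (l1 • g1 u + l2 • g2 u).det →
    ∀ i j k, christoffelR (fun v => l1 • g1 v + l2 • g2 v) i j k u =
      l1 * christoffelR g1 i j k u + l2 * christoffelR g2 i j k u

/-- Two metrics are compatible on `U` if additionally the raised curvature tensors of every
(invertible) linear combination are the corresponding linear combination. -/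
def CompatibleOn {N : ℕ} (g1 g2 : MetF N) (U : Set (Fin N → ℝ)) : Prop :=
  AlmostCompatibleOn g1 g2 U ∧
  ∀ l1 l2 : ℝ, ∀ u ∈ U, IsUnit (l1 • g1 u + l2 • g2 u).det →
    ∀ i j k l, curvatureR (fun v => l1 • g1 v + l2 • g2 v) i j k l u =
      l1 * curvatureR g1 i j k l u + l2 * curvatureR g2 i j k l u

/-- The Nijenhuis tensor `N^k_{ij}` of an affinor `v^i_j(u)`. -/
noncomputable def nijenhuisT {N : ℕ} (v : MetF N) (k i j : Fin N) (u : Fin N → ℝ) : ℝ :=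
  ∑ s, (v u s i * pd (fun w => v w k j) s u - v u s j * pd (fun w => v w k i) s u +
        v u k s * pd (fun w => v w s i) j u - v u k s * pd (fun w => v w s j) i u)


noncomputable def dM {N : ℕ} (g : MetF N) (k : Fin N) (u : Fin N → ℝ) : Matrix (Fin N) (Fin N) ℝ :=
  Matrix.of fun i j => pd (fun w => g w i j) k u

def DiffM {N : ℕ} (g : MetF N) (u : Fin N → ℝ) : Prop :=
  ∀ i j, DifferentiableAt ℝ (fun w => g w i j) u

open Filter Topology

lemma dM_mul {N : ℕ} {g h : MetF N} {u : Fin N → ℝ} (hg : DiffM g u) (hh : DiffM h u) (k : Fin N) :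
    dM (fun w => g w * h w) k u = dM g k u * h u + g u * dM h k u := by
  ext i j
  simp only [dM, Matrix.of_apply, Matrix.add_apply, Matrix.mul_apply, pd]
  rw [fderiv_fun_sum (fun s _ => (hg i s).fun_mul (hh s j))]
  simp only [_root_.sum_apply]
  rw [← Finset.sum_add_distrib]
  refine Finset.sum_congr rfl fun s _ => ?_
  rw [fderiv_fun_mul (hg i s) (hh s j)]
  simp
  ring

lemma DiffM.mul {N : ℕ} {g h : MetF N} {u : Fin N → ℝ} (hg : DiffM g u) (hh : DiffM h u) :
    DiffM (fun w => g w * h w) u := by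
  intro i j
  simp only [Matrix.mul_apply]
  exact DifferentiableAt.fun_sum (fun s _ => (hg i s).mul (hh s j))

lemma DiffM.det {N n : ℕ} {g : (Fin N → ℝ) → Matrix (Fin n) (Fin n) ℝ} {u : Fin N → ℝ}
    (hg : ∀ i j, DifferentiableAt ℝ (fun w => g w i j) u) :
    DifferentiableAt ℝ (fun w => (g w).det) u := by
  simp only [Matrix.det_apply]
  refine DifferentiableAt.fun_sum fun s _ => ?_
  refine DifferentiableAt.const_smul ?_ _
  exact (HasFDerivAt.finsetProd (u := Finset.univ) (g := fun i w => g w (s i) i)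
    fun i _ => (hg (s i) i).hasFDerivAt).differentiableAt

lemma DiffM.inv {N : ℕ} {g : MetF N} {u : Fin N → ℝ} (hg : DiffM g u) (hu : IsUnit (g u).det) :
    DiffM (fun w => (g w)⁻¹) u := by
  intro i j
  simp only [Matrix.inv_def, Matrix.smul_apply, Ring.inverse_eq_inv', smul_eq_mul]
  refine ((DiffM.det hg).inv hu.ne_zero).mul ?_
  simp only [Matrix.adjugate_apply]
  refine DiffM.det fun a b => ?_
  simp only [Matrix.updateRow_apply]
  split_ifs
  · exact differentiableAt_const _
  · exact hg _ _

lemma dM_congr {N : ℕ} {g h : MetF N} {u : Fin N → ℝ} (e : ∀ᶠ w in 𝓝 u, g w = h w) (k : Fin N) :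
    dM g k u = dM h k u := by
  ext i j
  simp only [dM, Matrix.of_apply, pd]
  rw [Filter.EventuallyEq.fderiv_eq]
  filter_upwards [e] with w hw
  rw [hw]

lemma DiffM.ev {N : ℕ} {g : MetF N} {u : Fin N → ℝ} (hg : DiffM g u) (hu : IsUnit (g u).det) :
    ∀ᶠ w in 𝓝 u, IsUnit (g w).det := by
  have := (DiffM.det hg).continuousAt.eventually_ne hu.ne_zero
  filter_upwards [this] with w hw using hw.isUnit

lemma dM_inv {N : ℕ} {g : MetF N} {u : Fin N → ℝ} (hg : DiffM g u) (hu : IsUnit (g u).det)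
    (k : Fin N) : g u * dM (fun w => (g w)⁻¹) k u * g u = - dM g k u := by
  have h1 := dM_mul hg (hg.inv hu) k
  have h2 : dM (fun w => g w * (g w)⁻¹) k u = 0 := by
    rw [dM_congr (h := fun _ => 1)]
    · ext i j; simp [dM, pd]
    · filter_upwards [hg.ev hu] with w hw using Matrix.mul_nonsing_inv _ hw
  rw [h2] at h1
  have h3 : g u * dM (fun w => (g w)⁻¹) k u = - (dM g k u * (g u)⁻¹) := by
    rw [eq_neg_iff_add_eq_zero, add_comm]; exact h1.symm
  rw [h3, Matrix.neg_mul, Matrix.mul_assoc, Matrix.nonsing_inv_mul _ hu, Matrix.mul_one]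

/-- the quadratic tensor -/
def TT {N : ℕ} (g : Matrix (Fin N) (Fin N) ℝ) (A : Fin N → Matrix (Fin N) (Fin N) ℝ)
    (i j : Fin N) : Fin N → ℝ := fun b => ∑ t, (g j t * A t i b - g i t * A t j b)

noncomputable def SS {N : ℕ} (g : MetF N) (i j : Fin N) (u : Fin N → ℝ) : Fin N → ℝ :=
  fun k => 2 * christoffelR g i j k u + dM g k u i j

lemma chR {N : ℕ} (g : MetF N) (u : Fin N → ℝ) (hs : (g u).IsSymm) (i j k : Fin N) :
    2 * christoffelR g i j k u = ∑ s, g u i s * (g u * dM (fun w => (g w)⁻¹) s u) j k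
      + (g u * dM (fun w => (g w)⁻¹) k u * g u) i j
      - ∑ t, g u j t * (g u * dM (fun w => (g w)⁻¹) t u) i k := by
  have e : (g u * dM (fun w => (g w)⁻¹) k u * g u) i j
      = ∑ s, ∑ t, g u i s * (g u j t * dM (fun w => (g w)⁻¹) k u s t) := by
    simp only [Matrix.mul_apply, Finset.sum_mul]
    rw [Finset.sum_comm]
    refine Finset.sum_congr rfl fun s _ => Finset.sum_congr rfl fun t _ => ?_
    rw [hs.apply j t]; ring
  rw [e]
  simp only [Matrix.mul_apply, Finset.mul_sum]
  rw [Finset.sum_comm (f := fun t x => g u j t * (g u i x * dM (fun w => (g w)⁻¹) t u x k))]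
  simp only [christoffelR, christoffel, Finset.mul_sum, ← Finset.sum_add_distrib,
    ← Finset.sum_sub_distrib, dM, Matrix.of_apply]
  refine Finset.sum_congr rfl fun s _ => Finset.sum_congr rfl fun t _ => ?_
  ring

lemma SS_mul {N : ℕ} (g : MetF N) (u : Fin N → ℝ) (hg : DiffM g u) (hs : (g u).IsSymm)
    (hu : IsUnit (g u).det) (i j : Fin N) :
    SS g i j u ᵥ* g u = TT (g u) (fun k => dM g k u) i j := by
  have e : SS g i j u = fun k => ∑ s, g u i s * (g u * dM (fun w => (g w)⁻¹) s u) j k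
      - ∑ t, g u j t * (g u * dM (fun w => (g w)⁻¹) t u) i k := by
    ext k
    simp only [SS, chR g u hs, dM_inv hg hu, Matrix.neg_apply]
    ring
  rw [e]
  ext b
  have key : ∀ i j, ∑ k, (∑ s, g u i s * (g u * dM (fun w => (g w)⁻¹) s u) j k) * g u k b
      = - ∑ s, g u i s * dM g s u j b := by
    intro i j
    simp only [Finset.sum_mul]
    rw [Finset.sum_comm, ← Finset.sum_neg_distrib]
    refine Finset.sum_congr rfl fun s _ => ?_
    have := congrFun (congrFun (dM_inv hg hu s) j) b
    rw [Matrix.neg_apply, Matrix.mul_apply] at this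
    rw [← mul_neg, ← this, Finset.mul_sum]
    exact Finset.sum_congr rfl fun k _ => by ring
  simp only [Matrix.vecMul, dotProduct, sub_mul, Finset.sum_sub_distrib, key, TT]
  ring

lemma TT_lin {N : ℕ} (g h : Matrix (Fin N) (Fin N) ℝ) (A B : Fin N → Matrix (Fin N) (Fin N) ℝ)
    (i j : Fin N) (x y : ℝ) : TT (x • g + y • h) (fun k => x • A k + y • B k) i j =
      (x * x) • TT g A i j + (x * y) • (TT g B i j + TT h A i j) + (y * y) • TT h B i j := by
  ext b
  simp only [TT, Pi.add_apply, Pi.smul_apply, smul_eq_mul, Matrix.add_apply, Matrix.smul_apply,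
    Finset.mul_sum, ← Finset.sum_add_distrib]
  exact Finset.sum_congr rfl fun k _ => by ring

lemma dM_lin {N : ℕ} {g h : MetF N} {u : Fin N → ℝ} (hg : DiffM g u) (hh : DiffM h u) (x y : ℝ)
    (k : Fin N) : dM (fun w => x • g w + y • h w) k u = x • dM g k u + y • dM h k u := by
  ext i j
  simp only [dM, Matrix.of_apply, Matrix.add_apply, Matrix.smul_apply, pd, smul_eq_mul]
  rw [fderiv_fun_add ((hg i j).const_mul x) ((hh i j).const_mul y),
    fderiv_const_mul (hg i j), fderiv_const_mul (hh i j)]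
  simp

lemma DiffM.lin {N : ℕ} {g h : MetF N} {u : Fin N → ℝ} (hg : DiffM g u) (hh : DiffM h u) (x y : ℝ) :
    DiffM (fun w => x • g w + y • h w) u := fun i j =>
  ((hg i j).const_mul x).add ((hh i j).const_mul y)

noncomputable def MM {N : ℕ} (g h : MetF N) (i j : Fin N) (u : Fin N → ℝ) : Fin N → ℝ :=
  SS g i j u ᵥ* h u + SS h i j u ᵥ* g u
    - (TT (g u) (fun k => dM h k u) i j + TT (h u) (fun k => dM g k u) i j)

lemma comb {N : ℕ} {g h : MetF N} {u : Fin N → ℝ} (hg : DiffM g u) (hh : DiffM h u)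
    (sg : (g u).IsSymm) (sh : (h u).IsSymm) (ug : IsUnit (g u).det) (uh : IsUnit (h u).det)
    (x y : ℝ) (hL : IsUnit (x • g u + y • h u).det) (i j : Fin N) :
    (∀ k, christoffelR (fun v => x • g v + y • h v) i j k u =
      x * christoffelR g i j k u + y * christoffelR h i j k u) ↔ (x * y) • MM g h i j u = 0 := by
  have h1 : (∀ k, christoffelR (fun v => x • g v + y • h v) i j k u =
      x * christoffelR g i j k u + y * christoffelR h i j k u) ↔
      x • SS g i j u + y • SS h i j u = SS (fun v => x • g v + y • h v) i j u := by
    rw [funext_iff]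
    refine forall_congr' fun k => ?_
    simp only [SS, dM_lin hg hh, Pi.add_apply, Pi.smul_apply, smul_eq_mul, Matrix.add_apply,
      Matrix.smul_apply]
    constructor <;> intro H <;> linarith
  have hinj : Function.Injective (fun p : Fin N → ℝ => p ᵥ* (x • g u + y • h u)) :=
    Matrix.vecMul_injective_of_isUnit ((Matrix.isUnit_iff_isUnit_det _).2 hL)
  rw [h1, ← hinj.eq_iff]
  have h2 := SS_mul (fun v => x • g v + y • h v) u (hg.lin hh x y) ((sg.smul x).add (sh.smul y))
    hL i j
  simp only [dM_lin hg hh, TT_lin] at h2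
  simp only [h2, ← SS_mul g u hg sg ug, ← SS_mul h u hh sh uh, MM]
  simp only [Matrix.add_vecMul, Matrix.vecMul_add, Matrix.smul_vecMul, Matrix.vecMul_smul]
  rw [← sub_eq_zero]
  refine Eq.congr ?_ rfl
  module

lemma MM_mul {N : ℕ} {g h : MetF N} {u : Fin N → ℝ} (hg : DiffM g u) (hh : DiffM h u)
    (sg : (g u).IsSymm) (sh : (h u).IsSymm) (ug : IsUnit (g u).det) (uh : IsUnit (h u).det)
    (i j : Fin N) : (g u * (h u)⁻¹) *ᵥ MM g h i j u =
      TT (g u) (fun k => dM g k u) i j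
      - (g u * (h u)⁻¹) *ᵥ (TT (g u) (fun k => dM h k u) i j + TT (h u) (fun k => dM g k u) i j)
      + (g u * (h u)⁻¹) *ᵥ ((g u * (h u)⁻¹) *ᵥ TT (h u) (fun k => dM h k u) i j) := by
  have e1 : SS g i j u ᵥ* h u = h u *ᵥ SS g i j u := by
    rw [← Matrix.mulVec_transpose, sh.eq]
  have e2 : SS h i j u ᵥ* g u = g u *ᵥ SS h i j u := by
    rw [← Matrix.mulVec_transpose, sg.eq]
  have e3 := SS_mul g u hg sg ug i j
  have e4 := SS_mul h u hh sh uh i j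
  rw [← Matrix.mulVec_transpose, sg.eq] at e3
  rw [← Matrix.mulVec_transpose, sh.eq] at e4
  rw [MM, e1, e2, ← e3, ← e4]
  simp only [Matrix.mulVec_sub, Matrix.mulVec_add, Matrix.mulVec_mulVec]
  have e5 : g u * (h u)⁻¹ * h u = g u := by
    rw [Matrix.mul_assoc, Matrix.nonsing_inv_mul _ uh, Matrix.mul_one]
  have e6 : g u * (h u)⁻¹ * (g u * (h u)⁻¹ * h u) = g u * (h u)⁻¹ * g u := by rw [e5]
  rw [e5]
  try rw [e6]
  abel

lemma nij {N : ℕ} {g h : MetF N} {u : Fin N → ℝ} (hg : DiffM g u) (hh : DiffM h u)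
    (sg : (g u).IsSymm) (sh : (h u).IsSymm) (ug : IsUnit (g u).det) (uh : IsUnit (h u).det)
    (sA : ∀ k, (dM g k u).IsSymm) (sB : ∀ k, (dM h k u).IsSymm)
    (k a b : Fin N) :
    (h u * (Matrix.of fun i j => nijenhuisT (fun w => g w * (h w)⁻¹) k i j u) * h u) a b
      = ((g u * (h u)⁻¹) *ᵥ MM g h b a u) k := by
  rw [MM_mul hg hh sg sh ug uh]
  set V : MetF N := fun w => g w * (h w)⁻¹ with hV
  have dV : DiffM V u := hg.mul (hh.inv uh)
  have hVu : g u * (h u)⁻¹ = V u := rfl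
  rw [hVu]
  have e5 : V u * h u = g u := by
    rw [← hVu, Matrix.mul_assoc, Matrix.nonsing_inv_mul _ uh, Matrix.mul_one]
  have e5' : h u * (V u)ᵀ = g u := by
    have := congrArg Matrix.transpose e5
    rwa [Matrix.transpose_mul, sg.eq, sh.eq] at this
  have hd : ∀ s, dM V s u * h u = dM g s u - V u * dM h s u := by
    intro s
    have := dM_mul dV hh s
    rw [eq_sub_iff_add_eq, ← this]
    refine dM_congr ?_ s
    filter_upwards [hh.ev uh] with w hw
    rw [hV]; simp only
    rw [Matrix.mul_assoc, Matrix.nonsing_inv_mul _ hw, Matrix.mul_one]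
  set D : Matrix (Fin N) (Fin N) ℝ := Matrix.of fun s j => dM V s u k j with hD
  set Q : Matrix (Fin N) (Fin N) ℝ := Matrix.of fun j i => (V u * dM V j u) k i with hQ
  have hN : (Matrix.of fun i j => nijenhuisT V k i j u)
      = ((V u)ᵀ * D - Q) - ((V u)ᵀ * D - Q)ᵀ := by
    ext i j
    simp only [nijenhuisT, hD, hQ, Matrix.of_apply, Matrix.sub_apply, Matrix.mul_apply,
      Matrix.transpose_apply, dM, Finset.sum_add_distrib, Finset.sum_sub_distrib]
    ring
  have hR : ∀ a b, (h u * ((V u)ᵀ * D - Q) * h u) a b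
      = ∑ s, g u a s * (dM g s u - V u * dM h s u) k b
        - ∑ s, h u a s * (V u * (dM g s u - V u * dM h s u)) k b := by
    intro a b
    have : h u * ((V u)ᵀ * D - Q) * h u = g u * (D * h u) - h u * (Q * h u) := by
      rw [Matrix.mul_sub, Matrix.sub_mul, ← Matrix.mul_assoc, e5', Matrix.mul_assoc,
        Matrix.mul_assoc]
    rw [this, Matrix.sub_apply, Matrix.mul_apply, Matrix.mul_apply]
    congr 1
    · refine Finset.sum_congr rfl fun s _ => ?_
      rw [← hd s]; simp only [hD, Matrix.mul_apply, Matrix.of_apply]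
    · refine Finset.sum_congr rfl fun s _ => ?_
      rw [← hd s, ← Matrix.mul_assoc, Matrix.mul_apply (M := Q), Matrix.mul_apply (M := V u * _)]
      simp only [hQ, Matrix.of_apply]
  have hT : h u * ((V u)ᵀ * D - Q)ᵀ * h u = (h u * ((V u)ᵀ * D - Q) * h u)ᵀ := by
    generalize (V u)ᵀ * D - Q = X
    rw [Matrix.transpose_mul, Matrix.transpose_mul, sh.eq, Matrix.mul_assoc]
  rw [hN, Matrix.mul_sub, Matrix.sub_mul, Matrix.sub_apply, hT, Matrix.transpose_apply, hR, hR]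
  have hTT : ∀ (W p : Matrix (Fin N) (Fin N) ℝ) (C : Fin N → Matrix (Fin N) (Fin N) ℝ),
      (∀ s, (C s).IsSymm) → (W *ᵥ TT p C b a) k
        = ∑ s, p a s * (W * C s) k b - ∑ s, p b s * (W * C s) k a := by
    intro W p C hC
    simp only [Matrix.mulVec, dotProduct, TT, Matrix.mul_apply, Finset.mul_sum,
      ← Finset.sum_sub_distrib]
    rw [Finset.sum_comm]
    refine Finset.sum_congr rfl fun s _ => Finset.sum_congr rfl fun t _ => ?_
    rw [(hC s).apply t b, (hC s).apply t a]; ring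
  have h0 : TT (g u) (fun k => dM g k u) b a = 1 *ᵥ TT (g u) (fun k => dM g k u) b a := by simp
  rw [h0]
  simp only [Pi.add_apply, Pi.sub_apply, Matrix.mulVec_add, Matrix.mulVec_mulVec,
    hTT _ _ _ sA, hTT _ _ _ sB, Matrix.one_mul, Matrix.mul_sub, Matrix.sub_apply, mul_sub,
    Finset.sum_sub_distrib, Matrix.mul_assoc]
  ring

lemma dM_symm {N : ℕ} {g : MetF N} {u : Fin N → ℝ} (e : ∀ᶠ w in 𝓝 u, (g w).IsSymm) (k : Fin N) :
    (dM g k u).IsSymm := by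
  have := dM_congr (h := fun w => (g w)ᵀ) (e.mono fun w hw => hw.eq.symm) k
  rw [Matrix.IsSymm]
  conv_rhs => rw [this]
  rfl

theorem almostCompatible_iff_nijenhuis_vanishes {N : ℕ}
    (U : Set (Fin N → ℝ)) (hU : IsOpen U)
    (g1 g2 : MetF N) (hg1 : IsMetricOn g1 U) (hg2 : IsMetricOn g2 U) :
    AlmostCompatibleOn g1 g2 U ↔
      ∀ u ∈ U, ∀ k i j : Fin N, nijenhuisT (fun w => g1 w * (g2 w)⁻¹) k i j u = 0 := by
  obtain ⟨c1, s1, d1⟩ := hg1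
  obtain ⟨c2, s2, d2⟩ := hg2
  have D1 : ∀ u ∈ U, DiffM g1 u := fun u hu i j =>
    ((c1 i j).contDiffAt (hU.mem_nhds hu)).differentiableAt (by simp)
  have D2 : ∀ u ∈ U, DiffM g2 u := fun u hu i j =>
    ((c2 i j).contDiffAt (hU.mem_nhds hu)).differentiableAt (by simp)
  have key1 : AlmostCompatibleOn g1 g2 U ↔ ∀ u ∈ U, ∀ i j, MM g1 g2 i j u = 0 := by
    constructor
    · intro H u hu i j
      have hc : Continuous fun t : ℝ => ((1 : ℝ) • g1 u + t • g2 u).det := by fun_prop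
      have hne : ∀ᶠ t in 𝓝 (0 : ℝ), ((1 : ℝ) • g1 u + t • g2 u).det ≠ 0 := by
        refine hc.continuousAt.eventually_ne ?_
        simpa using (d1 u hu).ne_zero
      have hne' := (hne.filter_mono (nhdsWithin_le_nhds (s := {0}ᶜ))).and self_mem_nhdsWithin
      obtain ⟨t, ht, ht0⟩ := hne'.exists
      have := (comb (D1 u hu) (D2 u hu) (s1 u hu) (s2 u hu) (d1 u hu) (d2 u hu) 1 t ht.isUnit i j).1
        (H 1 t u hu ht.isUnit i j)
      rw [smul_eq_zero] at this
      refine this.resolve_left ?_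
      simpa using ht0
    · intro H x y u hu hL i j
      refine (comb (D1 u hu) (D2 u hu) (s1 u hu) (s2 u hu) (d1 u hu) (d2 u hu) x y hL i j).2 ?_
      rw [H u hu, smul_zero]
  rw [key1]
  refine forall₂_congr fun u hu => ?_
  have n := nij (D1 u hu) (D2 u hu) (s1 u hu) (s2 u hu) (d1 u hu) (d2 u hu)
    (dM_symm (by filter_upwards [hU.mem_nhds hu] using s1))
    (dM_symm (by filter_upwards [hU.mem_nhds hu] using s2))
  have u2 : IsUnit (g2 u) := (Matrix.isUnit_iff_isUnit_det _).2 (d2 u hu)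
  have u1 : IsUnit (g1 u) := (Matrix.isUnit_iff_isUnit_det _).2 (d1 u hu)
  constructor
  · intro H k i j
    have : g2 u * (Matrix.of fun i j => nijenhuisT (fun w => g1 w * (g2 w)⁻¹) k i j u) * g2 u
        = 0 := by
      ext a b
      rw [n, H]; simp
    rw [u2.mul_left_eq_zero, u2.mul_right_eq_zero] at this
    exact congrFun (congrFun this i) j
  · intro H i j
    have hv : IsUnit (g1 u * (g2 u)⁻¹) := u1.mul ((Matrix.isUnit_nonsing_inv_iff).2 u2)
    refine Matrix.mulVec_injective_of_isUnit hv ?_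
    ext k
    rw [← n k j i]
    have : (Matrix.of fun i j => nijenhuisT (fun w => g1 w * (g2 w)⁻¹) k i j u) = 0 := by
      ext a b; exact H k a b
    rw [this]; simp
end

section
/- Let U ⊆ ℝ^N be open, let g^1, ..., g^N : U → ℝ be smooth nowhere-vanishing functions, and let f^1, ..., f^N : ℝ → ℝ be smooth nowhere-vanishing functions of one variable. Define the diagonal metrics g2^{ij}(u) = g^i(u) δ^{ij} and g1^{ij}(u) = f^i(u^i) g^i(u) δ^{ij} on U. Then g1 and g2 are compatible, i.e., for all real constants λ1, λ2 and every u ∈ U at which λ1 g1(u) + λ2 g2(u) is invertible, both the raised Christoffel symbols and the raised curvature tensors of λ1 g1 + λ2 g2 are the corresponding linear combinations of those of g1 and g2. -/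
open Matrix

lemma pd_congr {N : ℕ} {f g : (Fin N → ℝ) → ℝ} {V : Set (Fin N → ℝ)} (hV : IsOpen V)
    (h : ∀ v ∈ V, f v = g v) {u : Fin N → ℝ} (hu : u ∈ V) (j : Fin N) : pd f j u = pd g j u := by
  have : f =ᶠ[nhds u] g := Filter.eventuallyEq_of_mem (hV.mem_nhds hu) h
  simp [pd, this.fderiv_eq]

lemma pd_zero {N : ℕ} (j : Fin N) (u : Fin N → ℝ) : pd (fun _ => (0:ℝ)) j u = 0 := by
  simp [pd]

lemma pd_add {N : ℕ} {f g : (Fin N → ℝ) → ℝ} {u : Fin N → ℝ} (j : Fin N)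
    (hf : DifferentiableAt ℝ f u) (hg : DifferentiableAt ℝ g u) :
    pd (fun v => f v + g v) j u = pd f j u + pd g j u := by
  simp [pd, fderiv_fun_add hf hg]

lemma pd_mul {N : ℕ} {f g : (Fin N → ℝ) → ℝ} {u : Fin N → ℝ} (j : Fin N)
    (hf : DifferentiableAt ℝ f u) (hg : DifferentiableAt ℝ g u) :
    pd (fun v => f v * g v) j u = pd f j u * g u + f u * pd g j u := by
  simp [pd, fderiv_fun_mul hf hg]; ring

lemma pd_const_mul {N : ℕ} {f : (Fin N → ℝ) → ℝ} {u : Fin N → ℝ} (j : Fin N) (c : ℝ)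
    (hf : DifferentiableAt ℝ f u) :
    pd (fun v => c * f v) j u = c * pd f j u := by
  simp [pd, fderiv_const_mul hf]

lemma pd_inv {N : ℕ} {f : (Fin N → ℝ) → ℝ} {u : Fin N → ℝ} (j : Fin N)
    (hf : DifferentiableAt ℝ f u) (h0 : f u ≠ 0) :
    pd (fun v => (f v)⁻¹) j u = - pd f j u / (f u)^2 := by
  have := (hasDerivAt_inv h0).comp_hasFDerivAt u hf.hasFDerivAt |>.fderiv
  unfold pd
  erw [this]
  simp; field_simp

lemma pd_smooth {N : ℕ} {f : (Fin N → ℝ) → ℝ} {V : Set (Fin N → ℝ)} (hV : IsOpen V)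
    (hf : ContDiffOn ℝ (⊤ : ℕ∞) f V) (j : Fin N) : ContDiffOn ℝ (⊤ : ℕ∞) (pd f j) V := by
  have := hf.fderiv_of_isOpen (m := (⊤ : ℕ∞)) hV (by simp)
  exact this.clm_apply contDiffOn_const

lemma smooth_diff {N : ℕ} {f : (Fin N → ℝ) → ℝ} {V : Set (Fin N → ℝ)} (hV : IsOpen V)
    (hf : ContDiffOn ℝ (⊤ : ℕ∞) f V) {u : Fin N → ℝ} (hu : u ∈ V) : DifferentiableAt ℝ f u :=
  ((hf.contDiffAt (hV.mem_nhds hu)).differentiableAt (by simp))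

lemma pd_symm {N : ℕ} {f : (Fin N → ℝ) → ℝ} {V : Set (Fin N → ℝ)} (hV : IsOpen V)
    (hf : ContDiffOn ℝ (⊤ : ℕ∞) f V) {u : Fin N → ℝ} (hu : u ∈ V) (j k : Fin N) :
    pd (pd f j) k u = pd (pd f k) j u := by
  have hs : IsSymmSndFDerivAt ℝ f u :=
    (hf.contDiffAt (hV.mem_nhds hu)).isSymmSndFDerivAt (by
      simp only [minSmoothness_of_isRCLikeNormedField]; exact WithTop.coe_le_coe.2 (le_top : (2:ℕ∞) ≤ ⊤))
  have hd : DifferentiableAt ℝ (fderiv ℝ f) u := by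
    have := hf.fderiv_of_isOpen (m := (⊤ : ℕ∞)) hV (by simp)
    exact (this.contDiffAt (hV.mem_nhds hu)).differentiableAt (by simp)
  have key : ∀ a b : Fin N, pd (pd f a) b u
      = fderiv ℝ (fderiv ℝ f) u (Pi.single b 1) (Pi.single a 1) := by
    intro a b
    have := (hd.hasFDerivAt.clm_apply (hasFDerivAt_const (Pi.single a (1:ℝ) : Fin N → ℝ) u)).fderiv
    unfold pd
    erw [this]
    simp
  rw [key, key]
  exact hs _ _

/-- logarithmic derivative -/
noncomputable def ldv {N : ℕ} (G : Fin N → (Fin N → ℝ) → ℝ) (i j : Fin N) (v : Fin N → ℝ) : ℝ :=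
  pd (G i) j v * (G i v)⁻¹

section gen
variable {N : ℕ} {V : Set (Fin N → ℝ)} {G : Fin N → (Fin N → ℝ) → ℝ}

lemma ldv_smooth (hV : IsOpen V) (hG : ∀ i, ContDiffOn ℝ (⊤ : ℕ∞) (G i) V)
    (h0 : ∀ i, ∀ u ∈ V, G i u ≠ 0) (i j : Fin N) : ContDiffOn ℝ (⊤ : ℕ∞) (ldv G i j) V :=
  (pd_smooth hV (hG i) j).mul ((hG i).inv (h0 i))

lemma ldv_symm (hV : IsOpen V) (hG : ∀ i, ContDiffOn ℝ (⊤ : ℕ∞) (G i) V)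
    (h0 : ∀ i, ∀ u ∈ V, G i u ≠ 0) {u : Fin N → ℝ} (hu : u ∈ V) (i j k : Fin N) :
    pd (ldv G i j) k u = pd (ldv G i k) j u := by
  have key : ∀ a b : Fin N, pd (ldv G i a) b u =
      pd (pd (G i) a) b u * (G i u)⁻¹ + pd (G i) a u * (- pd (G i) b u / (G i u)^2) := by
    intro a b
    unfold ldv
    have d3 : DifferentiableAt ℝ (fun v => (G i v)⁻¹) u :=
      smooth_diff hV ((hG i).inv (h0 i)) hu
    rw [pd_mul _ (smooth_diff hV (pd_smooth hV (hG i) a) hu) d3, pd_inv _ (smooth_diff hV (hG i) hu) (h0 i u hu)]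
  rw [key, key, pd_symm hV (hG i) hu]; ring

lemma inv_diag (h0 : ∀ i, ∀ u ∈ V, G i u ≠ 0) {u : Fin N → ℝ} (hu : u ∈ V) :
    (Matrix.diagonal fun i => G i u)⁻¹ = Matrix.diagonal fun i => (G i u)⁻¹ := by
  apply Matrix.inv_eq_right_inv
  rw [Matrix.diagonal_mul_diagonal, ← Matrix.diagonal_one]
  congr 1; ext i
  exact mul_inv_cancel₀ (h0 i u hu)

lemma pd_inv_diag (hV : IsOpen V) (hG : ∀ i, ContDiffOn ℝ (⊤ : ℕ∞) (G i) V)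
    (h0 : ∀ i, ∀ u ∈ V, G i u ≠ 0) {u : Fin N → ℝ} (hu : u ∈ V) (s k j : Fin N) :
    pd (fun v => (Matrix.diagonal fun i => G i v)⁻¹ s k) j u
      = if s = k then - ldv G s j u * (G s u)⁻¹ else 0 := by
  rw [pd_congr (g := fun v => (Matrix.diagonal fun i => (G i v)⁻¹) s k) hV
    (fun v hv => by rw [inv_diag h0 hv]) hu]
  split_ifs with h
  · subst h
    simp only [Matrix.diagonal_apply_eq]
    rw [pd_inv _ (smooth_diff hV (hG s) hu) (h0 s u hu), ldv]
    have := h0 s u hu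
    field_simp
  · simp [Matrix.diagonal_apply_ne _ h, pd_zero]

/-- explicit Christoffel -/
noncomputable def chE (G : Fin N → (Fin N → ℝ) → ℝ) (i j k : Fin N) (u : Fin N → ℝ) : ℝ :=
  (if i = k then -(1/2) else 0) * ldv G i j u + (if i = j then -(1/2) else 0) * ldv G i k u
    + (if j = k then 1/2 else 0) * (G i u * ((G j u)⁻¹ * ldv G j i u))

lemma christoffel_diag (hV : IsOpen V) (hG : ∀ i, ContDiffOn ℝ (⊤ : ℕ∞) (G i) V)
    (h0 : ∀ i, ∀ u ∈ V, G i u ≠ 0) {u : Fin N → ℝ} (hu : u ∈ V) (i j k : Fin N) :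
    christoffel (fun v => Matrix.diagonal fun i => G i v) i j k u = chE G i j k u := by
  unfold christoffel
  rw [Finset.sum_eq_single i (fun b _ hb => by
    simp [Matrix.diagonal_apply_ne _ hb.symm])
    (by simp)]
  simp only [pd_inv_diag hV hG h0 hu, Matrix.diagonal_apply_eq]
  have hi := h0 i u hu
  have hj := h0 j u hu
  clear h0
  unfold chE
  by_cases hij : i = j
  · subst hij
    by_cases hik : i = k
    · subst hik; simp; field_simp; ring
    · simp [hik]; field_simp
  · have hji : ¬ j = i := fun h => hij h.symm
    by_cases hik : i = k
    · subst hik; simp [hij, hji]; field_simp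
    · by_cases hjk : j = k
      · subst hjk; simp [hij, hji]; field_simp; simp
      · simp [hij, hji, hik, hjk]

/-- explicit derivative -/
noncomputable def dchE (G : Fin N → (Fin N → ℝ) → ℝ) (i j k l : Fin N) (u : Fin N → ℝ) : ℝ :=
  (if i = k then -(1/2) else 0) * pd (ldv G i j) l u
    + (if i = j then -(1/2) else 0) * pd (ldv G i k) l u
    + (if j = k then 1/2 else 0) * (G i u * (G j u)⁻¹ * (pd (ldv G j i) l u
        + ldv G j i u * (ldv G i l u - ldv G j l u)))

lemma pd_christoffel_diag (hV : IsOpen V) (hG : ∀ i, ContDiffOn ℝ (⊤ : ℕ∞) (G i) V)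
    (h0 : ∀ i, ∀ u ∈ V, G i u ≠ 0) {u : Fin N → ℝ} (hu : u ∈ V) (i j k l : Fin N) :
    pd (christoffel (fun v => Matrix.diagonal fun i => G i v) i j k) l u = dchE G i j k l u := by
  rw [pd_congr hV (fun v hv => christoffel_diag hV hG h0 hv i j k) hu]
  have d1 : ∀ a b, DifferentiableAt ℝ (ldv G a b) u :=
    fun a b => smooth_diff hV (ldv_smooth hV hG h0 a b) hu
  have d2 : ∀ a, DifferentiableAt ℝ (G a) u := fun a => smooth_diff hV (hG a) hu
  have d3 : ∀ a, DifferentiableAt ℝ (fun v => (G a v)⁻¹) u :=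
    fun a => smooth_diff hV ((hG a).inv (h0 a)) hu
  unfold chE
  rw [pd_add _ (((d1 _ _).const_mul _).fun_add ((d1 _ _).const_mul _))
      (((d2 _).fun_mul ((d3 _).fun_mul (d1 _ _))).const_mul _),
    pd_add _ ((d1 _ _).const_mul _) ((d1 _ _).const_mul _),
    pd_const_mul _ _ (d1 _ _), pd_const_mul _ _ (d1 _ _),
    pd_const_mul _ _ ((d2 _).fun_mul ((d3 _).fun_mul (d1 _ _))),
    pd_mul _ (d2 _) ((d3 _).fun_mul (d1 _ _)), pd_mul _ (d3 _) (d1 _ _), pd_inv _ (d2 _) (h0 _ u hu)]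
  unfold dchE
  have e : ∀ a b, pd (G a) b u = G a u * ldv G a b u := by
    intro a b
    have := h0 a u hu
    unfold ldv; field_simp
  rw [e, e]
  have := h0 i u hu
  have := h0 j u hu
  field_simp
  ring

end gen

section alg
variable {N : ℕ}

/-- Kronecker delta -/
def dl (a b : Fin N) : ℝ := if a = b then 1 else 0

lemma sum_formula (G : Fin N → ℝ) (P : Fin N → Fin N → ℝ) (i j k l : Fin N) :
    ∑ p, (dl j k * P j p + dl j p * P j k - dl p k * (G j * (G p)⁻¹ * P p j)) *
      (dl p l * P p i + dl p i * P p l - dl i l * (G p * (G i)⁻¹ * P i p))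
    = - (dl j k * dl i l * (G i)⁻¹) * ∑ p, P j p * P i p * G p
      + dl j k * P j l * P l i + dl j k * P j i * P i l
      + P j k * (dl j l * P j i + dl j i * P j l - dl i l * (G j * (G i)⁻¹ * P i j))
      - (G j * (G k)⁻¹ * P k j) *
        (dl k l * P k i + dl k i * P k l - dl i l * (G k * (G i)⁻¹ * P i k)) := by
  have key : ∀ p, (dl j k * P j p + dl j p * P j k - dl p k * (G j * (G p)⁻¹ * P p j)) *
      (dl p l * P p i + dl p i * P p l - dl i l * (G p * (G i)⁻¹ * P i p))
      = (- (dl j k * dl i l * (G i)⁻¹) * (P j p * P i p * G p))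
      + dl p l * (dl j k * P j p * P p i)
      + dl p i * (dl j k * P j p * P p l)
      + dl p j * (P j k *
          (dl p l * P p i + dl p i * P p l - dl i l * (G p * (G i)⁻¹ * P i p)))
      + dl p k * (- (G j * (G p)⁻¹ * P p j) *
          (dl p l * P p i + dl p i * P p l - dl i l * (G p * (G i)⁻¹ * P i p))) := by
    intro p
    have e1 : dl j p = dl p j := by simp [dl, eq_comm]
    rw [e1]
    ring
  have sd : ∀ (a : Fin N) (Y : Fin N → ℝ), ∑ p, dl p a * Y p = Y a := by
    intro a Y
    simp [dl]
  rw [Finset.sum_congr rfl (fun p _ => key p)]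
  simp only [Finset.sum_add_distrib, sd, ← Finset.mul_sum]
  ring

/-- linear Christoffel expression -/
noncomputable def chLin (g : Fin N → ℝ) (q : Fin N → Fin N → ℝ) (i j k : Fin N) (h h' : Fin N → ℝ) :
    ℝ :=
  -(1/2) * dl j k * (h i * g i * q j i + dl i j * (h' i * g i))
  - (1/2) * dl i j * (h i * g i * q j k + dl j k * (h' i * g i))
  + (1/2) * dl i k * (h j * g j * q i j + dl i j * (h' j * g j))

/-- half of linear curvature expression -/
noncomputable def cuB (g : Fin N → ℝ) (q : Fin N → Fin N → ℝ) (r : Fin N → Fin N → Fin N → ℝ)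
    (i j k l : Fin N) (h h' : Fin N → ℝ) : ℝ :=
  -(1/2) * dl j l * (h i * g i * r j i k)
  + (1/2) * dl i l * (h j * g j * r i j k + q i j * (h j * g j * q j k + dl j k * (h' j * g j))
      - h j * g j * q i j * q i k)
  + (1/4) * dl j k * q j l * (h i * g i * q l i + dl l i * (h' i * g i))
  + (1/4) * dl j k * q j i * (h i * g i * q i l + dl l i * (h' i * g i))
  - (1/4) * dl j k * dl i l * (∑ p, h p * (g p * q j p * q i p) + h' j * g j * q i j
      + h' i * g i * q j i)
  + (1/4) * dl j l * (h i * g i * q j k * q j i)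
  - (1/4) * dl i l * (q i j * (h j * g j * q j k + dl j k * (h' j * g j)))
  - (1/4) * dl i k * (h j * g j * q i j * q i l)
  + (1/4) * dl i l * q i k * (h j * g j * q k j + dl j k * (h' j * g j))

/-- linear curvature expression -/
noncomputable def cuLin (g : Fin N → ℝ) (q : Fin N → Fin N → ℝ) (r : Fin N → Fin N → Fin N → ℝ)
    (i j k l : Fin N) (h h' : Fin N → ℝ) : ℝ :=
  if i = j then 0 else if k = l then 0 else cuB g q r i j k l h h' - cuB g q r i j l k h h'

lemma chLin_lin (g : Fin N → ℝ) (q : Fin N → Fin N → ℝ) (i j k : Fin N)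
    (h h' f f' : Fin N → ℝ) (a b : ℝ) (e : ∀ i, h i = a * f i + b) (e' : ∀ i, h' i = a * f' i) :
    chLin g q i j k h h' = a * chLin g q i j k f f' + b * chLin g q i j k (fun _ => 1) (fun _ => 0) := by
  simp only [chLin, e, e']; ring

lemma cuLin_lin (g : Fin N → ℝ) (q : Fin N → Fin N → ℝ) (r : Fin N → Fin N → Fin N → ℝ)
    (i j k l : Fin N)
    (h h' f f' : Fin N → ℝ) (a b : ℝ) (e : ∀ i, h i = a * f i + b) (e' : ∀ i, h' i = a * f' i) :
    cuLin g q r i j k l h h'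
      = a * cuLin g q r i j k l f f' + b * cuLin g q r i j k l (fun _ => 1) (fun _ => 0) := by
  have key : ∀ k l, cuB g q r i j k l h h'
      = a * cuB g q r i j k l f f' + b * cuB g q r i j k l (fun _ => 1) (fun _ => 0) := by
    intro k l
    have s : ∑ p, h p * (g p * q j p * q i p) = a * ∑ p, f p * (g p * q j p * q i p)
        + b * ∑ p, 1 * (g p * q j p * q i p) := by
      rw [Finset.mul_sum, Finset.mul_sum, ← Finset.sum_add_distrib]
      refine Finset.sum_congr rfl fun p _ => ?_
      rw [e]; ring
    simp only [cuB, s]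
    simp only [e, e']; ring
  unfold cuLin
  split_ifs
  · ring
  · ring
  · rw [key, key]; ring

lemma chAlg (g h h' : Fin N → ℝ) (q P : Fin N → Fin N → ℝ) (hh : ∀ i, h i ≠ 0) (hg : ∀ i, g i ≠ 0)
    (hP : ∀ i j, P i j = q i j + dl i j * (h' i * (h i)⁻¹)) (i j k : Fin N) :
    h i * g i * (-(1/2) * (dl j k * P j i + dl j i * P j k
        - dl i k * (h j * g j * (h i * g i)⁻¹ * P i j)))
      = chLin g q i j k h h' := by
  have h1 := hh i
  have h2 := hh j
  have h3 := hg i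
  have h4 := hg j
  simp only [chLin, hP]
  by_cases hij : i = j
  · subst hij
    by_cases hik : i = k
    · subst hik; simp [dl]; field_simp; ring
    · simp [dl, hik]; field_simp
  · have hji : ¬ j = i := fun h => hij h.symm
    simp [dl, hij, hji]; split_ifs <;> subst_vars <;> field_simp <;> ring

/-- quadratic term -/
noncomputable def cuT (G : Fin N → ℝ) (P : Fin N → Fin N → ℝ) (i j k l : Fin N) : ℝ :=
  - (dl j k * dl i l * (G i)⁻¹) * ∑ p, P j p * P i p * G p
      + dl j k * P j l * P l i + dl j k * P j i * P i l
      + P j k * (dl j l * P j i + dl j i * P j l - dl i l * (G j * (G i)⁻¹ * P i j))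
      - (G j * (G k)⁻¹ * P k j) *
        (dl k l * P k i + dl k i * P k l - dl i l * (G k * (G i)⁻¹ * P i k))

/-- derivative term -/
noncomputable def cuD (G : Fin N → ℝ) (P : Fin N → Fin N → ℝ) (Q : Fin N → Fin N → Fin N → ℝ)
    (i j k l : Fin N) : ℝ :=
  -(1/2) * (dl j l * Q j i k + dl j i * Q j l k
    - dl i l * (G j * (G i)⁻¹ * (Q i j k + P i j * (P j k - P i k))))

lemma cuAlg (g h h' : Fin N → ℝ) (q P : Fin N → Fin N → ℝ) (r Q : Fin N → Fin N → Fin N → ℝ)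
    (hh : ∀ i, h i ≠ 0) (hg : ∀ i, g i ≠ 0)
    (hP : ∀ i j, P i j = q i j + dl i j * (h' i * (h i)⁻¹))
    (hQ : ∀ i j k, i ≠ j → Q i j k = r i j k) (hs : ∀ i j k, Q i j k = Q i k j) (i j k l : Fin N) :
    h i * g i * (cuD (fun i => h i * g i) P Q i j k l - cuD (fun i => h i * g i) P Q i j l k
      + (1/4) * (cuT (fun i => h i * g i) P i j k l - cuT (fun i => h i * g i) P i j l k))
      = cuLin g q r i j k l h h' := by
  have h1 := hh i
  have h2 := hh j
  have h3 := hg i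
  have h4 := hg j
  have h5 := hh k
  have h6 := hg k
  have h7 := hh l
  have h8 := hg l
  unfold cuLin
  by_cases hij : i = j
  · subst hij
    rw [if_pos rfl]
    unfold cuD cuT
    rw [hs i l k]
    by_cases hkl : k = l
    · subst hkl; simp
    have hlk : ¬ l = k := fun h => hkl h.symm
    by_cases hik : i = k
    · subst hik; simp [dl, hkl, hlk]; field_simp; ring_nf; simp
    have hki : ¬ k = i := fun h => hik h.symm
    by_cases hil : i = l
    · subst hil; simp [dl, hik, hki]; field_simp; ring_nf; simp
    have hli : ¬ l = i := fun h => hil h.symm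
    simp [dl, hkl, hlk, hik, hki, hil, hli]; ring_nf; simp
  rw [if_neg hij]
  by_cases hkl : k = l
  · subst hkl; simp
  rw [if_neg hkl]
  have hS : ∑ p, P j p * P i p * (h p * g p) = ∑ p, h p * (g p * q j p * q i p) + h' j * g j * q i j
      + h' i * g i * q j i := by
    have : ∀ p, P j p * P i p * (h p * g p) = h p * (g p * q j p * q i p)
        + (if p = j then h' j * g j * q i j else 0) + (if p = i then h' i * g i * q j i else 0) := by
      intro p
      have := hh p
      simp only [hP, dl]
      by_cases e1 : p = j
      · subst e1; simp [hij, Ne.symm hij]; field_simp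
      · by_cases e2 : p = i
        · subst e2; simp [hij, Ne.symm hij]; field_simp
        · simp [e1, e2, Ne.symm e1, Ne.symm e2]; ring
    rw [Finset.sum_congr rfl (fun p _ => this p)]
    simp only [Finset.sum_add_distrib, Finset.sum_ite_eq', Finset.mem_univ, if_true]
  have hji : ¬ j = i := fun h => hij h.symm
  have hlk : ¬ l = k := fun h => hkl h.symm
  have hS' : ∑ p, P i p * P j p * (h p * g p) = ∑ p, P j p * P i p * (h p * g p) :=
    Finset.sum_congr rfl fun p _ => by ring
  unfold cuD cuT cuB
  simp only [hS, hQ i j _ hij, hQ j i _ hji]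
  generalize ∑ p, h p * (g p * q j p * q i p) = S
  simp only [hP]
  by_cases hik : i = k
  · subst hik
    by_cases hjl : j = l
    · subst hjl; simp [dl, hij, hji]; field_simp; ring
    · have hlj : ¬ l = j := fun h => hjl h.symm
      simp [dl, hij, hji, hkl, hlk, hjl, hlj]; field_simp; ring
  have hki : ¬ k = i := fun h => hik h.symm
  by_cases hil : i = l
  · subst hil
    by_cases hjk : j = k
    · subst hjk; simp [dl, hij, hji]; field_simp; ring
    · have hkj : ¬ k = j := fun h => hjk h.symm
      simp [dl, hij, hji, hik, hki, hjk, hkj]; field_simp; ring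
  have hli : ¬ l = i := fun h => hil h.symm
  by_cases hjk : j = k
  · subst hjk
    simp [dl, hij, hji, hil, hli, hkl, hlk]; field_simp; ring
  have hkj : ¬ k = j := fun h => hjk h.symm
  by_cases hjl : j = l
  · subst hjl
    simp [dl, hij, hji, hik, hki, hjk, hkj]; field_simp; ring
  · have hlj : ¬ l = j := fun h => hjl h.symm
    simp [dl, hij, hji, hik, hki, hil, hli, hjk, hkj, hkl, hlk, hjl, hlj]

end alg

section fin
variable {N : ℕ} {V : Set (Fin N → ℝ)}

lemma pd_comp (h : ℝ → ℝ) (hd : Differentiable ℝ h) (i j : Fin N) (u : Fin N → ℝ) :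
    pd (fun v => h (v i)) j u = dl i j * deriv h (u i) := by
  have h1 : HasFDerivAt (fun v : Fin N → ℝ => v i)
      (ContinuousLinearMap.proj (R := ℝ) (φ := fun _ : Fin N => ℝ) i) u :=
    hasFDerivAt_apply i u
  have h2 := (hd (u i)).hasDerivAt.comp_hasFDerivAt u h1
  have h3 := h2.fderiv
  unfold pd
  erw [h3]
  by_cases e : i = j
  · subst e; simp [dl]
  · simp [dl, e]

lemma chE_eq (G : Fin N → (Fin N → ℝ) → ℝ) (i j k : Fin N) (u : Fin N → ℝ) :
    chE G i j k u = -(1/2) * (dl i k * ldv G i j u + dl i j * ldv G i k u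
        - dl j k * (G i u * (G j u)⁻¹ * ldv G j i u)) := by
  unfold chE dl
  split_ifs <;> ring

lemma dchE_eq (G : Fin N → (Fin N → ℝ) → ℝ) (i j k l : Fin N) (u : Fin N → ℝ) :
    dchE G j i l k u = cuD (fun i => G i u) (fun i j => ldv G i j u)
      (fun i j k => pd (ldv G i j) k u) i j k l := by
  unfold dchE cuD dl
  split_ifs <;> ring

variable (hV : IsOpen V) (g : Fin N → (Fin N → ℝ) → ℝ) (h : Fin N → ℝ → ℝ)
    (hgsm : ∀ i, ContDiffOn ℝ (⊤ : ℕ∞) (g i) V)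
    (hg0 : ∀ i, ∀ u ∈ V, g i u ≠ 0)
    (hhsm : ∀ i, ContDiff ℝ (⊤ : ℕ∞) (h i))
    (hh0 : ∀ i, ∀ u ∈ V, h i (u i) ≠ 0)

include hgsm hhsm in
lemma G_smooth (i : Fin N) : ContDiffOn ℝ (⊤ : ℕ∞) (fun v => h i (v i) * g i v) V := by
  have h1 : ContDiff ℝ (⊤ : ℕ∞) (fun v : Fin N → ℝ => h i (v i)) :=
    (hhsm i).comp (contDiff_apply ℝ ℝ i)
  exact h1.contDiffOn.mul (hgsm i)

include hV hgsm hg0 hhsm hh0 in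
lemma ldv_G {u : Fin N → ℝ} (hu : u ∈ V) (i j : Fin N) :
    ldv (fun i v => h i (v i) * g i v) i j u
      = ldv g i j u + dl i j * (deriv (h i) (u i) * (h i (u i))⁻¹) := by
  have h1 : ContDiff ℝ (⊤ : ℕ∞) (fun v : Fin N → ℝ => h i (v i)) :=
    (hhsm i).comp (contDiff_apply ℝ ℝ i)
  have e1 := hg0 i u hu
  have e2 := hh0 i u hu
  unfold ldv
  rw [pd_mul _ (h1.differentiable (by simp) u) (smooth_diff hV (hgsm i) hu),
    pd_comp _ ((hhsm i).differentiable (by simp))]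
  field_simp
  ring

include hV hgsm hg0 hhsm hh0 in
lemma christoffelR_eq {u : Fin N → ℝ} (hu : u ∈ V) (i j k : Fin N) :
    christoffelR (fun v => Matrix.diagonal fun i => h i (v i) * g i v) i j k u
      = chLin (fun i => g i u) (fun i j => ldv g i j u) i j k (fun i => h i (u i))
          (fun i => deriv (h i) (u i)) := by
  unfold christoffelR
  rw [Finset.sum_eq_single i (fun b _ hb => by
    simp [Matrix.diagonal_apply_ne _ hb.symm]) (by simp)]
  have := christoffel_diag (G := fun i v => h i (v i) * g i v) hV (G_smooth g h hgsm hhsm)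
    (fun i u hu => mul_ne_zero (hh0 i u hu) (hg0 i u hu)) hu j i k
  rw [this, chE_eq]
  simp only [Matrix.diagonal_apply_eq]
  exact chAlg (fun i => g i u) (fun i => h i (u i)) (fun i => deriv (h i) (u i))
    (fun i j => ldv g i j u) (fun i j => ldv (fun i v => h i (v i) * g i v) i j u)
    (fun i => hh0 i u hu) (fun i => hg0 i u hu)
    (fun i j => ldv_G hV g h hgsm hg0 hhsm hh0 hu i j) i j k

include hV hgsm hg0 hhsm hh0 in
lemma curvatureR_eq {u : Fin N → ℝ} (hu : u ∈ V) (i j k l : Fin N) :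
    curvatureR (fun v => Matrix.diagonal fun i => h i (v i) * g i v) i j k l u
      = cuLin (fun i => g i u) (fun i j => ldv g i j u) (fun i j k => pd (ldv g i j) k u)
          i j k l (fun i => h i (u i)) (fun i => deriv (h i) (u i)) := by
  have hG := G_smooth g h hgsm hhsm
  have hG0 : ∀ i, ∀ u ∈ V, h i (u i) * g i u ≠ 0 :=
    fun i u hu => mul_ne_zero (hh0 i u hu) (hg0 i u hu)
  have hch := fun i j k => christoffel_diag (G := fun i v => h i (v i) * g i v) hV hG hG0 hu i j k
  have hdch := fun i j k l =>
    pd_christoffel_diag (G := fun i v => h i (v i) * g i v) hV hG hG0 hu i j k l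
  unfold curvatureR
  rw [Finset.sum_eq_single i (fun b _ hb => by
    simp [Matrix.diagonal_apply_ne _ hb.symm]) (by simp)]
  unfold curvature
  have hsum : ∀ k l, ∑ p, chE (fun i v => h i (v i) * g i v) j p k u
      * chE (fun i v => h i (v i) * g i v) p i l u
      = (1/4) * cuT (fun i => h i (u i) * g i u)
        (fun i j => ldv (fun i v => h i (v i) * g i v) i j u) i j k l := by
    intro k l
    refine Eq.trans ?_ (congrArg (fun x => (1/4) * x) (sum_formula (fun i => h i (u i) * g i u)
      (fun i j => ldv (fun i v => h i (v i) * g i v) i j u) i j k l))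
    rw [Finset.mul_sum]
    refine Finset.sum_congr rfl fun p _ => ?_
    rw [chE_eq, chE_eq]
    ring
  simp only [hch, hdch]
  rw [Finset.sum_sub_distrib, hsum, hsum, ← mul_sub, dchE_eq, dchE_eq]
  simp only [Matrix.diagonal_apply_eq]
  refine cuAlg (fun i => g i u) (fun i => h i (u i)) (fun i => deriv (h i) (u i))
    (fun i j => ldv g i j u) (fun i j => ldv (fun i v => h i (v i) * g i v) i j u)
    (fun i j k => pd (ldv g i j) k u)
    (fun i j k => pd (ldv (fun i v => h i (v i) * g i v) i j) k u)
    (fun i => hh0 i u hu) (fun i => hg0 i u hu)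
    (fun i j => ldv_G hV g h hgsm hg0 hhsm hh0 hu i j) ?_ ?_ i j k l
  · intro i j k hij
    refine pd_congr hV (fun v hv => ?_) hu k
    rw [ldv_G hV g h hgsm hg0 hhsm hh0 hv i j]
    simp [dl, hij]
  · intro i j k
    exact ldv_symm (G := fun i v => h i (v i) * g i v) hV hG hG0 hu i j k

end fin
/-- Any pair of diagonal metrics `g2^{ij}(u) = g^i(u) δ^{ij}` and
`g1^{ij}(u) = f^i(u^i) g^i(u) δ^{ij}`, with `g^i` smooth and nowhere vanishing on `U` and `f^i`
smooth nowhere-vanishing functions of one variable, is compatible on `U`. -/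
theorem special_diagonal_metrics_are_compatible {N : ℕ}
    (U : Set (Fin N → ℝ)) (hU : IsOpen U)
    (g : Fin N → (Fin N → ℝ) → ℝ) (f : Fin N → ℝ → ℝ)
    (hgsm : ∀ i, ContDiffOn ℝ (⊤ : ℕ∞) (g i) U)
    (hg0 : ∀ i, ∀ u ∈ U, g i u ≠ 0)
    (hfsm : ∀ i, ContDiff ℝ (⊤ : ℕ∞) (f i))
    (hf0 : ∀ i, ∀ t : ℝ, f i t ≠ 0) :
    CompatibleOn (fun u => Matrix.diagonal fun i => f i (u i) * g i u)
      (fun u => Matrix.diagonal fun i => g i u) U := by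
  have comb : ∀ l1 l2 : ℝ, (fun v : Fin N → ℝ =>
      l1 • (Matrix.diagonal fun i => f i (v i) * g i v) + l2 • (Matrix.diagonal fun i => g i v))
      = fun v => Matrix.diagonal fun i => (fun i t => l1 * f i t + l2) i (v i) * g i v := by
    intro l1 l2
    funext v
    rw [← Matrix.diagonal_smul, ← Matrix.diagonal_smul, Matrix.diagonal_add]
    congr 1
    funext i
    simp only [Pi.smul_apply, smul_eq_mul]
    ring
  have one : (fun v : Fin N → ℝ => Matrix.diagonal fun i => g i v)
      = fun v => Matrix.diagonal fun i => (fun (_ : Fin N) (_ : ℝ) => (1:ℝ)) i (v i) * g i v := by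
    funext v
    simp
  have main : ∀ l1 l2 : ℝ, ∀ u ∈ U, IsUnit ((l1 • (Matrix.diagonal fun i => f i (u i) * g i u)
      + l2 • (Matrix.diagonal fun i => g i u)).det) →
      ∃ V : Set (Fin N → ℝ), IsOpen V ∧ u ∈ V ∧ V ⊆ U ∧
        ∀ i, ∀ v ∈ V, (fun i t => l1 * f i t + l2) i (v i) ≠ 0 := by
    intro l1 l2 u hu hdet
    rw [congrFun (comb l1 l2) u, Matrix.det_diagonal, isUnit_iff_ne_zero,
      Finset.prod_ne_zero_iff] at hdet
    refine ⟨U ∩ ⋂ i, {v | l1 * f i (v i) + l2 ≠ 0}, hU.inter (isOpen_iInter_of_finite fun i => ?_),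
      ⟨hu, Set.mem_iInter.2 fun i => left_ne_zero_of_mul (hdet i (Finset.mem_univ i))⟩,
      Set.inter_subset_left, fun i v hv => Set.mem_iInter.1 hv.2 i⟩
    have hc := (hfsm i).continuous
    exact isOpen_ne_fun (by fun_prop) continuous_const
  have sm : ∀ l1 l2 : ℝ, ∀ i, ContDiff ℝ (⊤ : ℕ∞) ((fun (i : Fin N) t => l1 * f i t + l2) i) :=
    fun l1 l2 i => (contDiff_const.mul (hfsm i)).add contDiff_const
  have dv : ∀ l1 l2 : ℝ, ∀ (u : Fin N → ℝ) i,
      deriv ((fun (i : Fin N) t => l1 * f i t + l2) i) (u i) = l1 * deriv (f i) (u i) := by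
    intro l1 l2 u i
    have hd : DifferentiableAt ℝ (f i) (u i) := (hfsm i).differentiable (by simp) _
    simp [deriv_const_mul _ hd]
  have d1 : ∀ (u : Fin N → ℝ), (fun i : Fin N => deriv ((fun (_ : Fin N) (_ : ℝ) => (1:ℝ)) i) (u i))
      = fun _ => 0 := by
    intro u; funext i; simp
  refine ⟨?_, ?_⟩
  · intro l1 l2 u hu hdet i j k
    obtain ⟨V, hV, huV, hVU, hh0⟩ := main l1 l2 u hu hdet
    have e0 := christoffelR_eq hV g (fun i t => l1 * f i t + l2) (fun i => (hgsm i).mono hVU)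
      (fun i u hu => hg0 i u (hVU hu)) (sm l1 l2) hh0 huV i j k
    have e1 := christoffelR_eq hU g f hgsm hg0 hfsm (fun i u _ => hf0 i (u i)) hu i j k
    have e2 := christoffelR_eq hU g (fun _ _ => 1) hgsm hg0 (fun i => contDiff_const)
      (fun i u _ => one_ne_zero) hu i j k
    rw [d1] at e2
    rw [← one] at e2
    rw [← comb] at e0
    rw [e0, e1, e2]
    exact chLin_lin _ _ _ _ _ _ _ _ _ _ _ (fun i => rfl) (fun i => dv l1 l2 u i)
  · intro l1 l2 u hu hdet i j k l
    obtain ⟨V, hV, huV, hVU, hh0⟩ := main l1 l2 u hu hdet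
    have e0 := curvatureR_eq hV g (fun i t => l1 * f i t + l2) (fun i => (hgsm i).mono hVU)
      (fun i u hu => hg0 i u (hVU hu)) (sm l1 l2) hh0 huV i j k l
    have e1 := curvatureR_eq hU g f hgsm hg0 hfsm (fun i u _ => hf0 i (u i)) hu i j k l
    have e2 := curvatureR_eq hU g (fun _ _ => 1) hgsm hg0 (fun i => contDiff_const)
      (fun i u _ => one_ne_zero) hu i j k l
    rw [d1] at e2
    rw [← one] at e2
    rw [← comb] at e0
    rw [e0, e1, e2]
    exact cuLin_lin _ _ _ _ _ _ _ _ _ _ _ _ _ (fun i => rfl) (fun i => dv l1 l2 u i)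
end
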